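/- arXiv:2310.14470 — 2 statements merged into one kernel-verified Lean document; each statement's English description precedes it below -/
import Mathlib

section
/- Assume (v̂·ŵ)² ≠ 1 and q ≠ 2. Define A_{m,n,p} = ∫₀¹ βⁿ R(1,β)^{−p} dβ − ∫₀¹ α^{m+n} R(α,α)^{−p} dα and B_{m,n,p} = ∫₀¹ α^{m+n} R(α,α)^{−p} dα − [n = 0] ∫₀¹ αᵐ R(α,0)^{−p} dα. Then the recursion in the second index holds: T_{m,n+1,q} = 1/((v̂·ŵ)² − 1) · [ B_{m,n,q−2}/(L₂²(q−2)) − (v̂·ŵ) A_{m,n,q−2}/(L₁L₂(q−2)) − n T_{m,n−1,q−2}/(L₂²(q−2)) + (v̂·ŵ) m T_{m−1,n,q−2}/(L₁L₂(q−2)) + ((x₀·ŵ − (v̂·ŵ)(x₀·v̂))/L₂) T_{m,n,q} ], where terms with factor m (resp. n) are interpreted as 0 when m = 0 (resp. n = 0). -/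
open scoped RealInnerProductSpace

section Triangle

open MeasureTheory Set

/-- Fubini's theorem on the triangle `0 ≤ β ≤ α ≤ 1`. -/
theorem integral_triangle_swap {f : ℝ → ℝ → ℝ} (hf : Continuous f.uncurry) :
    ∫ α in (0:ℝ)..1, ∫ β in (0:ℝ)..α, f α β = ∫ β in (0:ℝ)..1, ∫ α in β..1, f α β := by
  set S : Set (ℝ × ℝ) := {p | p.2 ≤ p.1}
  have hS : MeasurableSet S := measurableSet_le measurable_snd measurable_fst
  have hint : Integrable (Function.uncurry fun α β => S.indicator f.uncurry (α, β))
      ((volume.restrict (Ioc (0:ℝ) 1)).prod (volume.restrict (Ioc (0:ℝ) 1))) := by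
    have h : IntegrableOn f.uncurry (Ioc (0:ℝ) 1 ×ˢ Ioc (0:ℝ) 1) (volume.prod volume) :=
      (hf.continuousOn.integrableOn_compact (isCompact_Icc.prod isCompact_Icc)).mono_set
        (prod_mono Ioc_subset_Icc_self Ioc_subset_Icc_self)
    rw [IntegrableOn, ← Measure.prod_restrict] at h
    exact h.indicator hS
  have key := integral_integral_swap hint
  rw [intervalIntegral.integral_of_le zero_le_one, intervalIntegral.integral_of_le zero_le_one]
  convert key using 1
  · refine setIntegral_congr_fun measurableSet_Ioc fun α hα => ?_
    have : (fun β => S.indicator f.uncurry (α, β)) = (Iic α).indicator (f α) := by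
      ext β; by_cases h : β ≤ α <;> simp [S, h]
    simp only [this]
    rw [intervalIntegral.integral_of_le hα.1.le, setIntegral_indicator measurableSet_Iic,
      Ioc_inter_Iic, min_eq_right hα.2]
  · refine setIntegral_congr_fun measurableSet_Ioc fun β hβ => ?_
    have : (fun α => S.indicator f.uncurry (α, β)) = (Ici β).indicator (fun α => f α β) := by
      ext α; by_cases h : β ≤ α <;> simp [S, h]
    have hset : Ioc 0 1 ∩ Ici β = Icc β 1 := by
      ext α
      simp only [mem_inter_iff, mem_Ioc, mem_Ici, mem_Icc]
      exact ⟨fun h => ⟨h.2, h.1.2⟩, fun h => ⟨⟨hβ.1.trans_le h.1, h.2⟩, h.1⟩⟩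
    simp only [this]
    rw [intervalIntegral.integral_of_le hβ.2, setIntegral_indicator measurableSet_Ici, hset,
      integral_Icc_eq_integral_Ioc]

/-- Integrating a derivative in the inner variable over the triangle. -/
theorem integral_triangle_deriv_snd {f f' : ℝ → ℝ → ℝ} (hf : Continuous f.uncurry)
    (hf' : Continuous f'.uncurry) (h : ∀ α β, HasDerivAt (f α) (f' α β) β) :
    ∫ α in (0:ℝ)..1, ∫ β in (0:ℝ)..α, f' α β =
      (∫ α in (0:ℝ)..1, f α α) - ∫ α in (0:ℝ)..1, f α 0 := by
  rw [← intervalIntegral.integral_sub]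
  · refine intervalIntegral.integral_congr fun α _ => ?_
    exact intervalIntegral.integral_eq_sub_of_hasDerivAt (fun β _ => h α β)
      (Continuous.intervalIntegrable (by fun_prop) _ _)
  all_goals exact Continuous.intervalIntegrable (by fun_prop) _ _

/-- Integrating a derivative in the outer variable over the triangle. -/
theorem integral_triangle_deriv_fst {f f' : ℝ → ℝ → ℝ} (hf : Continuous f.uncurry)
    (hf' : Continuous f'.uncurry) (h : ∀ α β, HasDerivAt (fun x => f x β) (f' α β) α) :
    ∫ α in (0:ℝ)..1, ∫ β in (0:ℝ)..α, f' α β =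
      (∫ β in (0:ℝ)..1, f 1 β) - ∫ β in (0:ℝ)..1, f β β := by
  rw [integral_triangle_swap hf', ← intervalIntegral.integral_sub]
  · refine intervalIntegral.integral_congr fun β _ => ?_
    exact intervalIntegral.integral_eq_sub_of_hasDerivAt (fun α _ => h α β)
      (Continuous.intervalIntegrable (by fun_prop) _ _)
  all_goals exact Continuous.intervalIntegrable (by fun_prop) _ _

theorem integral_triangle_add {f g : ℝ → ℝ → ℝ} (hf : Continuous f.uncurry)
    (hg : Continuous g.uncurry) :
    ∫ α in (0:ℝ)..1, ∫ β in (0:ℝ)..α, (f α β + g α β) =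
      (∫ α in (0:ℝ)..1, ∫ β in (0:ℝ)..α, f α β) + ∫ α in (0:ℝ)..1, ∫ β in (0:ℝ)..α, g α β := by
  rw [← intervalIntegral.integral_add]
  · refine intervalIntegral.integral_congr fun α _ => ?_
    exact intervalIntegral.integral_add (Continuous.intervalIntegrable (by fun_prop) _ _)
      (Continuous.intervalIntegrable (by fun_prop) _ _)
  all_goals exact Continuous.intervalIntegrable (by fun_prop) _ _

theorem integral_triangle_const_mul (c : ℝ) (f : ℝ → ℝ → ℝ) :
    ∫ α in (0:ℝ)..1, ∫ β in (0:ℝ)..α, c * f α β =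
      c * ∫ α in (0:ℝ)..1, ∫ β in (0:ℝ)..α, f α β := by
  simp only [intervalIntegral.integral_const_mul]

/-- A four-term linear combination may be integrated termwise over the triangle. -/
theorem integral_triangle_linear_combination {f₁ f₂ f₃ f₄ : ℝ → ℝ → ℝ}
    (h₁ : Continuous f₁.uncurry) (h₂ : Continuous f₂.uncurry)
    (h₃ : Continuous f₃.uncurry) (h₄ : Continuous f₄.uncurry) (c₁ c₂ c₃ c₄ : ℝ) :
    ∫ α in (0:ℝ)..1, ∫ β in (0:ℝ)..α,
        (c₁ * f₁ α β + (c₂ * f₂ α β + (c₃ * f₃ α β + c₄ * f₄ α β))) =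
      c₁ * (∫ α in (0:ℝ)..1, ∫ β in (0:ℝ)..α, f₁ α β) +
        (c₂ * (∫ α in (0:ℝ)..1, ∫ β in (0:ℝ)..α, f₂ α β) +
        (c₃ * (∫ α in (0:ℝ)..1, ∫ β in (0:ℝ)..α, f₃ α β) +
          c₄ * ∫ α in (0:ℝ)..1, ∫ β in (0:ℝ)..α, f₄ α β)) := by
  rw [integral_triangle_add (by fun_prop) (by fun_prop),
    integral_triangle_add (by fun_prop) (by fun_prop),
    integral_triangle_add (by fun_prop) (by fun_prop)]
  simp only [integral_triangle_const_mul]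

end Triangle

/-- Derivative of a monomial times a negative power of the square root of a function. -/
theorem HasDerivAt.pow_mul_sqrt_rpow {Q : ℝ → ℝ} {Q' x : ℝ} (hQ : HasDerivAt Q (2 * Q') x)
    (hpos : 0 < Q x) (n : ℕ) (q : ℝ) :
    HasDerivAt (fun x => x ^ n * √(Q x) ^ (-(q - 2)))
      (n * x ^ (n - 1) * √(Q x) ^ (-(q - 2)) - (q - 2) * (x ^ n * Q' * √(Q x) ^ (-q))) x := by
  have hs : √(Q x) ≠ 0 := (Real.sqrt_pos.2 hpos).ne'
  have h := (hasDerivAt_pow n x).mul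
    ((hQ.sqrt hpos.ne').rpow_const (p := -(q - 2)) (Or.inl hs))
  refine h.congr_deriv ?_
  have e : √(Q x) ^ (-(q - 2) - 1) = √(Q x) * √(Q x) ^ (-q) := by
    rw [show -(q - 2) - 1 = -q + 1 by ring, Real.rpow_add_one hs, mul_comm]
  rw [e]
  field_simp
  ring

/-- Recursion in the second index for the triangle integrals `T_{m,n,q}`. -/
theorem T_recursion_second_index
    (y₀ y₁ y₂ xf : EuclideanSpace ℝ (Fin 3))
    (hy01 : y₀ ≠ y₁) (hy12 : y₁ ≠ y₂)
    (L₁ L₂ ε : ℝ) (v w x₀ : EuclideanSpace ℝ (Fin 3))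
    (hL₁ : L₁ = ‖y₀ - y₁‖) (hv : v = L₁⁻¹ • (y₀ - y₁))
    (hL₂ : L₂ = ‖y₁ - y₂‖) (hw : w = L₂⁻¹ • (y₁ - y₂))
    (hx₀ : x₀ = xf - y₀) (hε : 0 < ε)
    (y : ℝ → ℝ → EuclideanSpace ℝ (Fin 3))
    (hy : ∀ α β : ℝ, y α β = y₀ - (α * L₁) • v - (β * L₂) • w)
    (R : ℝ → ℝ → ℝ)
    (hR : ∀ α β : ℝ, R α β = Real.sqrt (‖xf - y α β‖^2 + ε^2))
    (T : ℕ → ℕ → ℝ → ℝ)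
    (hT : ∀ (m n : ℕ) (q : ℝ),
      T m n q = ∫ α in (0:ℝ)..1, ∫ β in (0:ℝ)..α, α ^ m * β ^ n * R α β ^ (-q))
    (A B : ℕ → ℕ → ℝ → ℝ)
    (hA : ∀ (m n : ℕ) (p : ℝ),
      A m n p = (∫ β in (0:ℝ)..1, β ^ n * R 1 β ^ (-p)) -
        (∫ α in (0:ℝ)..1, α ^ (m + n) * R α α ^ (-p)))
    (hB : ∀ (m n : ℕ) (p : ℝ),
      B m n p = (∫ α in (0:ℝ)..1, α ^ (m + n) * R α α ^ (-p)) -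
        (if n = 0 then (1:ℝ) else 0) * (∫ α in (0:ℝ)..1, α ^ m * R α 0 ^ (-p)))
    (hvw : ⟪v, w⟫^2 ≠ 1) :
    ∀ (m n : ℕ) (q : ℝ), q ≠ 2 →
      T m (n + 1) q = (⟪v, w⟫^2 - 1)⁻¹ *
        (B m n (q - 2) / (L₂^2 * (q - 2)) -
          ⟪v, w⟫ * A m n (q - 2) / (L₁ * L₂ * (q - 2)) -
          (n : ℝ) * T m (n - 1) (q - 2) / (L₂^2 * (q - 2)) +
          ⟪v, w⟫ * (m : ℝ) * T (m - 1) n (q - 2) / (L₁ * L₂ * (q - 2)) +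
          (⟪x₀, w⟫ - ⟪v, w⟫ * ⟪x₀, v⟫) / L₂ * T m n q) := by
  intro m n q hq
  have hL₁pos : 0 < L₁ := hL₁ ▸ norm_pos_iff.2 (sub_ne_zero.2 hy01)
  have hL₂pos : 0 < L₂ := hL₂ ▸ norm_pos_iff.2 (sub_ne_zero.2 hy12)
  have hvn : ‖v‖ = 1 := by
    rw [hv, norm_smul, ← hL₁, norm_inv, Real.norm_of_nonneg hL₁pos.le, inv_mul_cancel₀ hL₁pos.ne']
  have hwn : ‖w‖ = 1 := by
    rw [hw, norm_smul, ← hL₂, norm_inv, Real.norm_of_nonneg hL₂pos.le, inv_mul_cancel₀ hL₂pos.ne']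
  set c := ⟪v, w⟫
  set a := ⟪x₀, v⟫
  set b := ⟪x₀, w⟫
  set Q : ℝ → ℝ → ℝ := fun α β => ‖xf - y α β‖ ^ 2 + ε ^ 2 with hQ
  have hQpos : ∀ α β, 0 < Q α β := fun α β => by positivity
  have hQexp : ∀ α β, Q α β = ‖x₀‖ ^ 2 + ε ^ 2 + 2 * (α * (L₁ * a)) + 2 * (β * (L₂ * b)) +
      α ^ 2 * L₁ ^ 2 + β ^ 2 * L₂ ^ 2 + 2 * (α * β * (L₁ * L₂ * c)) := by
    intro α β
    have : xf - y α β = x₀ + (α * L₁) • v + (β * L₂) • w := by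
      rw [hy, hx₀]; abel
    simp only [hQ]
    rw [this, norm_add_sq_real, norm_add_sq_real, inner_add_left, inner_smul_left,
      inner_smul_right, inner_smul_right, inner_smul_right, norm_smul, norm_smul, hvn, hwn,
      mul_one, mul_one, Real.norm_eq_abs, Real.norm_eq_abs, sq_abs, sq_abs, conj_trivial]
    ring
  have hRQ : ∀ α β, R α β = √(Q α β) := hR
  have hQfst : ∀ α β, HasDerivAt (fun x => Q x β)
      (2 * (L₁ ^ 2 * α + L₁ * a + L₁ * L₂ * c * β)) α := by
    intro α β
    simp only [hQexp]
    have h := hasDerivAt_id' α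
    refine ((((((h.mul_const (L₁ * a)).const_mul 2).const_add (‖x₀‖ ^ 2 + ε ^ 2)).add_const
      (2 * (β * (L₂ * b)))).add ((h.pow 2).mul_const (L₁ ^ 2))).add_const
      (β ^ 2 * L₂ ^ 2)).add (((h.mul_const β).mul_const (L₁ * L₂ * c)).const_mul 2)
      |>.congr_deriv ?_
    norm_num
    ring
  have hQsnd : ∀ α β, HasDerivAt (fun x => Q α x)
      (2 * (L₂ ^ 2 * β + L₂ * b + L₁ * L₂ * c * α)) β := by
    intro α β
    simp only [hQexp]
    have h := hasDerivAt_id' β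
    refine ((((h.mul_const (L₂ * b)).const_mul 2).const_add
      (‖x₀‖ ^ 2 + ε ^ 2 + 2 * (α * (L₁ * a)))).add_const (α ^ 2 * L₁ ^ 2)).add
      ((h.pow 2).mul_const (L₂ ^ 2)) |>.add
      (((h.const_mul α).mul_const (L₁ * L₂ * c)).const_mul 2) |>.congr_deriv ?_
    norm_num
    ring
  have hcont : ∀ (m n : ℕ) (q : ℝ),
      Continuous (Function.uncurry fun α β => α ^ m * β ^ n * R α β ^ (-q)) := by
    intro m n q
    have hR' : Continuous fun p : ℝ × ℝ => R p.1 p.2 := by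
      simp only [hRQ, hQexp]; fun_prop
    have hR'' : Continuous fun p : ℝ × ℝ => R p.1 p.2 ^ (-q) :=
      hR'.rpow_const fun p => Or.inl (by rw [hRQ]; exact (Real.sqrt_pos.2 (hQpos _ _)).ne')
    simp only [Function.uncurry_def]
    fun_prop
  have hBrel : B m n (q - 2) = n * T m (n - 1) (q - 2) - (q - 2) *
      (L₂ ^ 2 * T m (n + 1) q + L₂ * b * T m n q + L₁ * L₂ * c * T (m + 1) n q) := by
    have key := integral_triangle_deriv_snd (hcont m n (q - 2))
      (f' := fun α β => n * (α ^ m * β ^ (n - 1) * R α β ^ (-(q - 2))) +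
        ((-(q - 2) * L₂ ^ 2) * (α ^ m * β ^ (n + 1) * R α β ^ (-q)) +
        ((-(q - 2) * (L₂ * b)) * (α ^ m * β ^ n * R α β ^ (-q)) +
        (-(q - 2) * (L₁ * L₂ * c)) * (α ^ (m + 1) * β ^ n * R α β ^ (-q)))))
      (by
        have h₁ := hcont m (n - 1) (q - 2)
        have h₂ := hcont m (n + 1) q
        have h₃ := hcont m n q
        have h₄ := hcont (m + 1) n q
        simp only [Function.uncurry_def] at *
        fun_prop)
      (fun α β => by
        simp only [hRQ, mul_assoc (α ^ m)]
        refine (((hQsnd α β).pow_mul_sqrt_rpow (hQpos α β) n q).const_mul (α ^ m)).congr_deriv ?_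
        ring)
    rw [integral_triangle_linear_combination (hcont _ _ _) (hcont _ _ _) (hcont _ _ _)
      (hcont _ _ _), ← hT, ← hT, ← hT, ← hT] at key
    have hbd : B m n (q - 2) = (∫ α in (0:ℝ)..1, α ^ m * α ^ n * R α α ^ (-(q - 2))) -
        ∫ α in (0:ℝ)..1, α ^ m * 0 ^ n * R α 0 ^ (-(q - 2)) := by
      rw [hB]
      simp only [pow_add]
      by_cases hn : n = 0 <;> simp [hn]
    rw [hbd, ← key]
    ring
  have hArel : A m n (q - 2) = m * T (m - 1) n (q - 2) - (q - 2) *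
      (L₁ ^ 2 * T (m + 1) n q + L₁ * a * T m n q + L₁ * L₂ * c * T m (n + 1) q) := by
    have key := integral_triangle_deriv_fst (hcont m n (q - 2))
      (f' := fun α β => m * (α ^ (m - 1) * β ^ n * R α β ^ (-(q - 2))) +
        ((-(q - 2) * L₁ ^ 2) * (α ^ (m + 1) * β ^ n * R α β ^ (-q)) +
        ((-(q - 2) * (L₁ * a)) * (α ^ m * β ^ n * R α β ^ (-q)) +
        (-(q - 2) * (L₁ * L₂ * c)) * (α ^ m * β ^ (n + 1) * R α β ^ (-q)))))
      (by
        have h₁ := hcont (m - 1) n (q - 2)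
        have h₂ := hcont (m + 1) n q
        have h₃ := hcont m n q
        have h₄ := hcont m (n + 1) q
        simp only [Function.uncurry_def] at *
        fun_prop)
      (fun α β => by
        simp only [hRQ, mul_right_comm _ (β ^ n)]
        refine (((hQfst α β).pow_mul_sqrt_rpow (hQpos α β) m q).mul_const (β ^ n)).congr_deriv ?_
        ring)
    rw [integral_triangle_linear_combination (hcont _ _ _) (hcont _ _ _) (hcont _ _ _)
      (hcont _ _ _), ← hT, ← hT, ← hT, ← hT] at key
    have hbd : A m n (q - 2) = (∫ β in (0:ℝ)..1, 1 ^ m * β ^ n * R 1 β ^ (-(q - 2))) -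
        ∫ α in (0:ℝ)..1, α ^ m * α ^ n * R α α ^ (-(q - 2)) := by
      rw [hA]
      simp only [pow_add, one_pow, one_mul]
    rw [hbd, ← key]
    ring
  have hc : c ^ 2 - 1 ≠ 0 := sub_ne_zero.2 hvw
  have hp : q - 2 ≠ 0 := sub_ne_zero.2 hq
  have h₁ := hL₁pos.ne'
  have h₂ := hL₂pos.ne'
  rw [hBrel, hArel, eq_inv_mul_iff_mul_eq₀ hc]
  field_simp
  ring
end

section
/- Let v₁, v₂, v₃ ∈ ℝ² be vertices of a nondegenerate triangle listed in counterclockwise order, let T be their convex hull, let p ∈ ℝ² and γ > 0, and write R(x) = √(‖x − p‖² + γ²). Then ∫_T (‖x − p‖² + γ²)^{−1/2} dx = Σ_{i=1}^{3} ∫₀¹ ( (v_i + t e_i − p) · n_i ) / R_i(t) dt − γ² ∫_T (‖x − p‖² + γ²)^{−3/2} dx, where e_i = v_{i+1} − v_i (indices mod 3), n_i = ((e_i)_2, −(e_i)_1) is the outward normal to edge i scaled by its length, and R_i(t) = √(‖v_i + t e_i − p‖² + γ²). -/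
open MeasureTheory Set

/-- The closed triangle with vertices `(0, 0)`, `(1, 0)` and `(0, 1)`. -/
def unitTriangle : Set (ℝ × ℝ) := {x | 0 ≤ x.1 ∧ 0 ≤ x.2 ∧ x.1 + x.2 ≤ 1}

lemma isCompact_unitTriangle : IsCompact unitTriangle := by
  refine (isCompact_Icc (a := ((0, 0) : ℝ × ℝ)) (b := (1, 1))).of_isClosed_subset ?_ ?_
  · exact (isClosed_le continuous_const continuous_fst).inter
      ((isClosed_le continuous_const continuous_snd).inter
        (isClosed_le (continuous_fst.add continuous_snd) continuous_const))
  · rintro ⟨s, t⟩ ⟨hs, ht, hst⟩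
    simp only at hs ht hst
    exact ⟨⟨hs, ht⟩, by constructor <;> simp only <;> linarith⟩

/-- The affine parametrization of the plane sending the vertices `(0, 0)`, `(1, 0)`, `(0, 1)` of
the unit triangle to `u`, `v`, `w`. -/
def triangleParam (u v w x : ℝ × ℝ) : ℝ × ℝ :=
  (u.1 + x.1 * (v.1 - u.1) + x.2 * (w.1 - u.1), u.2 + x.1 * (v.2 - u.2) + x.2 * (w.2 - u.2))

lemma convexHull_eq_image_triangleParam (u v w : ℝ × ℝ) :
    convexHull ℝ {u, v, w} = triangleParam u v w '' unitTriangle := by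
  apply Subset.antisymm
  · refine convexHull_min ?_ ?_
    · rintro x (rfl | rfl | rfl)
      · exact ⟨(0, 0), by simp [unitTriangle], by simp [triangleParam]⟩
      · exact ⟨(1, 0), by simp [unitTriangle], by simp [triangleParam]⟩
      · exact ⟨(0, 1), by simp [unitTriangle], by simp [triangleParam]⟩
    · rintro _ ⟨x, ⟨hx₁, hx₂, hx⟩, rfl⟩ _ ⟨y, ⟨hy₁, hy₂, hy⟩, rfl⟩ a b ha hb hab
      refine ⟨a • x + b • y, ⟨?_, ?_, ?_⟩, ?_⟩
      · simp only [Prod.fst_add, Prod.smul_fst, smul_eq_mul]; positivity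
      · simp only [Prod.snd_add, Prod.smul_snd, smul_eq_mul]; positivity
      · simp only [Prod.fst_add, Prod.snd_add, Prod.smul_fst, Prod.smul_snd, smul_eq_mul]
        nlinarith
      · obtain rfl : b = 1 - a := by linarith
        ext <;> simp [triangleParam] <;> ring
  · rintro _ ⟨⟨s, t⟩, ⟨hs, ht, hst⟩, rfl⟩
    simp only at hs ht hst
    have h := (convex_convexHull ℝ {u, v, w}).sum_mem (t := Finset.univ)
      (w := ![1 - s - t, s, t]) (z := ![u, v, w])
      (by intro i _; fin_cases i <;> simp <;> linarith) (by simp [Fin.sum_univ_three]; ring)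
      (by intro i _; apply subset_convexHull; fin_cases i <;> simp)
    convert h using 1
    ext <;> simp [triangleParam, Fin.sum_univ_three] <;> ring

lemma hasFDerivAt_triangleParam (u v w x : ℝ × ℝ) :
    HasFDerivAt (triangleParam u v w)
      (LinearMap.toContinuousLinearMap (Matrix.toLin (Module.Basis.finTwoProd ℝ)
        (Module.Basis.finTwoProd ℝ) !![v.1 - u.1, w.1 - u.1; v.2 - u.2, w.2 - u.2])) x := by
  rw [Matrix.toLin_finTwoProd_toContinuousLinearMap]
  unfold triangleParam
  have h : ∀ a b c : ℝ, HasFDerivAt (fun x : ℝ × ℝ => a + x.1 * b + x.2 * c)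
      (b • ContinuousLinearMap.fst ℝ ℝ ℝ + c • ContinuousLinearMap.snd ℝ ℝ ℝ) x := fun a b c =>
    ((hasFDerivAt_fst.mul_const b).const_add a).add (hasFDerivAt_snd.mul_const c)
  exact (h _ _ _).prodMk (h _ _ _)

lemma injective_triangleParam {u v w : ℝ × ℝ}
    (h : (v.1 - u.1) * (w.2 - u.2) - (v.2 - u.2) * (w.1 - u.1) ≠ 0) :
    Function.Injective (triangleParam u v w) := by
  rintro ⟨s, t⟩ ⟨r, q⟩ hst
  simp only [triangleParam, Prod.mk.injEq] at hst
  obtain ⟨h₁, h₂⟩ := hst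
  ext
  · refine mul_left_cancel₀ h ?_
    linear_combination (w.2 - u.2) * h₁ - (w.1 - u.1) * h₂
  · refine mul_left_cancel₀ h ?_
    linear_combination (v.1 - u.1) * h₂ - (v.2 - u.2) * h₁

lemma setIntegral_convexHull_triangle {u v w : ℝ × ℝ}
    (h : 0 < (v.1 - u.1) * (w.2 - u.2) - (v.2 - u.2) * (w.1 - u.1)) (F : ℝ × ℝ → ℝ) :
    ∫ x in convexHull ℝ {u, v, w}, F x =
      ∫ x in unitTriangle, ((v.1 - u.1) * (w.2 - u.2) - (v.2 - u.2) * (w.1 - u.1)) *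
        F (triangleParam u v w x) := by
  rw [convexHull_eq_image_triangleParam, integral_image_eq_integral_abs_det_fderiv_smul volume
    isCompact_unitTriangle.measurableSet
    (fun x _ => (hasFDerivAt_triangleParam u v w x).hasFDerivWithinAt)
    (injective_triangleParam h.ne').injOn]
  have hdet : (LinearMap.toContinuousLinearMap (Matrix.toLin (Module.Basis.finTwoProd ℝ)
      (Module.Basis.finTwoProd ℝ) !![v.1 - u.1, w.1 - u.1; v.2 - u.2, w.2 - u.2])).det =
      (v.1 - u.1) * (w.2 - u.2) - (v.2 - u.2) * (w.1 - u.1) := by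
    simp only [ContinuousLinearMap.det, LinearMap.coe_toContinuousLinearMap, LinearMap.det_toLin,
      Matrix.det_fin_two_of]
    ring
  simp only [hdet, abs_of_pos h, smul_eq_mul]

lemma setIntegral_unitTriangle {F : ℝ × ℝ → ℝ} (hF : Continuous F) :
    ∫ x in unitTriangle, F x = ∫ t in (0 : ℝ)..1, ∫ s in (0 : ℝ)..(1 - t), F (s, t) := by
  have hm := isCompact_unitTriangle.measurableSet
  have hi := (hF.continuousOn.integrableOn_compact (μ := volume) isCompact_unitTriangle)
  rw [← integral_indicator hm, Measure.volume_eq_prod, integral_prod_symm,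
    intervalIntegral.integral_of_le zero_le_one, ← integral_Icc_eq_integral_Ioc,
    ← integral_indicator measurableSet_Icc]
  · congr 1 with t
    by_cases ht : t ∈ Icc (0 : ℝ) 1
    · rw [indicator_of_mem ht, intervalIntegral.integral_of_le (by linarith [ht.2]),
        ← integral_Icc_eq_integral_Ioc, ← integral_indicator measurableSet_Icc]
      congr 1 with s
      simp only [indicator, unitTriangle, mem_ofPred_eq, mem_Icc, ht.1, true_and, le_sub_iff_add_le]
    · rw [indicator_of_notMem ht]
      refine integral_eq_zero_of_ae (.of_forall fun s => indicator_of_notMem ?_ _)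
      rintro ⟨h₁, h₂, h₃⟩
      simp only at h₁ h₂ h₃
      exact ht ⟨h₂, by linarith⟩
  · exact (integrable_indicator_iff hm).2 hi

lemma setIntegral_unitTriangle_swap (F : ℝ × ℝ → ℝ) :
    ∫ x in unitTriangle, F x.swap = ∫ x in unitTriangle, F x := by
  have h := (Measure.measurePreserving_swap (μ := (volume : Measure ℝ)) (ν := volume)
    ).setIntegral_preimage_emb MeasurableEquiv.prodComm.measurableEmbedding F unitTriangle
  have hpre : Prod.swap ⁻¹' unitTriangle = unitTriangle := by
    ext x
    simp only [unitTriangle, mem_preimage, mem_ofPred_eq, Prod.fst_swap, Prod.snd_swap,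
      add_comm x.2, and_left_comm]
  rwa [hpre] at h

lemma setIntegral_unitTriangle_fderiv_fst {P : ℝ × ℝ → ℝ} (hP : ContDiff ℝ 1 P) :
    ∫ x in unitTriangle, fderiv ℝ P x (1, 0) =
      (∫ t in (0 : ℝ)..1, P (1 - t, t)) - ∫ t in (0 : ℝ)..1, P (0, t) := by
  have hc : Continuous fun x => fderiv ℝ P x (1, 0) :=
    (hP.continuous_fderiv one_ne_zero).clm_apply continuous_const
  have hPc := hP.continuous
  rw [setIntegral_unitTriangle hc, ← intervalIntegral.integral_sub
    (Continuous.intervalIntegrable (by fun_prop) _ _)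
    (Continuous.intervalIntegrable (by fun_prop) _ _)]
  congr 1 with t
  refine intervalIntegral.integral_eq_sub_of_hasDerivAt (f := fun s => P (s, t)) (fun s _ => ?_) ?_
  · exact ((hP.differentiable one_ne_zero _).hasFDerivAt).comp_hasDerivAt s
      ((hasDerivAt_id s).prodMk (hasDerivAt_const s t))
  · exact (hc.comp (by fun_prop)).intervalIntegrable _ _

lemma setIntegral_unitTriangle_fderiv_snd {Q : ℝ × ℝ → ℝ} (hQ : ContDiff ℝ 1 Q) :
    ∫ x in unitTriangle, fderiv ℝ Q x (0, 1) =
      (∫ t in (0 : ℝ)..1, Q (t, 1 - t)) - ∫ t in (0 : ℝ)..1, Q (t, 0) := by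
  rw [← setIntegral_unitTriangle_swap]
  have hs : ContDiff ℝ 1 (Prod.swap : ℝ × ℝ → ℝ × ℝ) := contDiff_snd.prodMk contDiff_fst
  refine Eq.trans ?_ (setIntegral_unitTriangle_fderiv_fst (hQ.comp hs))
  congr 1 with x
  have h : HasFDerivAt (Q ∘ Prod.swap) _ x := ((hQ.differentiable one_ne_zero _).hasFDerivAt).comp x
    (hasFDerivAt_snd.prodMk hasFDerivAt_fst)
  rw [h.fderiv]
  simp

lemma contDiff_triangleParam (u v w : ℝ × ℝ) : ContDiff ℝ 1 (triangleParam u v w) := by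
  unfold triangleParam
  fun_prop

/-- The divergence theorem on a counterclockwise planar triangle. -/
theorem setIntegral_convexHull_triangle_divergence {u v w : ℝ × ℝ}
    (h : 0 < (v.1 - u.1) * (w.2 - u.2) - (v.2 - u.2) * (w.1 - u.1)) {f g : ℝ × ℝ → ℝ}
    (hf : ContDiff ℝ 1 f) (hg : ContDiff ℝ 1 g) :
    ∫ x in convexHull ℝ {u, v, w}, (fderiv ℝ f x (1, 0) + fderiv ℝ g x (0, 1)) =
      (∫ t in (0 : ℝ)..1, (f (u + t • (v - u)) * (v - u).2 - g (u + t • (v - u)) * (v - u).1)) +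
      (∫ t in (0 : ℝ)..1, (f (v + t • (w - v)) * (w - v).2 - g (v + t • (w - v)) * (w - v).1)) +
      ∫ t in (0 : ℝ)..1, (f (w + t • (u - w)) * (u - w).2 - g (w + t • (u - w)) * (u - w).1) := by
  set A := triangleParam u v w with hA
  have hAc : ContDiff ℝ 1 A := contDiff_triangleParam u v w
  set P : ℝ × ℝ → ℝ := fun x => (w.2 - u.2) * f (A x) - (w.1 - u.1) * g (A x) with hP
  set Q : ℝ × ℝ → ℝ := fun x => (v.1 - u.1) * g (A x) - (v.2 - u.2) * f (A x) with hQ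
  have hPc : ContDiff ℝ 1 P := by fun_prop
  have hQc : ContDiff ℝ 1 Q := by fun_prop
  have hPQ : ∀ x, ((v.1 - u.1) * (w.2 - u.2) - (v.2 - u.2) * (w.1 - u.1)) *
      (fderiv ℝ f (A x) (1, 0) + fderiv ℝ g (A x) (0, 1)) =
      fderiv ℝ P x (1, 0) + fderiv ℝ Q x (0, 1) := by
    intro x
    have hfx := ((hf.differentiable one_ne_zero (A x)).hasFDerivAt).comp x
      (hasFDerivAt_triangleParam u v w x)
    have hgx := ((hg.differentiable one_ne_zero (A x)).hasFDerivAt).comp x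
      (hasFDerivAt_triangleParam u v w x)
    have hPx : HasFDerivAt P _ x := (hfx.const_mul (w.2 - u.2)).sub (hgx.const_mul (w.1 - u.1))
    have hQx : HasFDerivAt Q _ x := (hgx.const_mul (v.1 - u.1)).sub (hfx.const_mul (v.2 - u.2))
    have hlin : ∀ (L : ℝ × ℝ →L[ℝ] ℝ) (a b : ℝ), L (a, b) = a * L (1, 0) + b * L (0, 1) := by
      intro L a b
      rw [← smul_eq_mul, ← smul_eq_mul, ← map_smul, ← map_smul, ← map_add]
      simp
    rw [hPx.fderiv, hQx.fderiv]
    simp only [Matrix.toLin_finTwoProd_toContinuousLinearMap, sub_apply,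
      smul_apply, ContinuousLinearMap.comp_apply, smul_eq_mul,
      ContinuousLinearMap.prod_apply, add_apply,
      ContinuousLinearMap.coe_fst', ContinuousLinearMap.coe_snd', mul_one, mul_zero, add_zero,
      zero_add]
    rw [hlin _ (v.1 - u.1), hlin _ (w.1 - u.1), hlin _ (v.1 - u.1), hlin _ (w.1 - u.1)]
    ring
  have hint : ∀ {F : ℝ × ℝ → ℝ} (c : ℝ × ℝ), ContDiff ℝ 1 F →
      IntegrableOn (fun x => fderiv ℝ F x c) unitTriangle := fun c hF =>
    ((hF.continuous_fderiv one_ne_zero).clm_apply continuous_const).continuousOn.integrableOn_compact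
      isCompact_unitTriangle
  rw [setIntegral_convexHull_triangle h]
  simp only [← hA, hPQ]
  rw [integral_add (hint _ hPc) (hint _ hQc), setIntegral_unitTriangle_fderiv_fst hPc,
    setIntegral_unitTriangle_fderiv_snd hQc]
  have hPcont := hPc.continuous
  have hQcont := hQc.continuous
  have hflipQ : ∫ t in (0 : ℝ)..1, Q (t, 1 - t) = ∫ t in (0 : ℝ)..1, Q (1 - t, t) := by
    simpa using (intervalIntegral.integral_comp_sub_left (a := 0) (b := 1)
      (fun t => Q (1 - t, t)) 1)
  have hflipP : ∫ t in (0 : ℝ)..1, P (0, t) = ∫ t in (0 : ℝ)..1, P (0, 1 - t) := by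
    simpa using (intervalIntegral.integral_comp_sub_left (a := 0) (b := 1)
      (fun t => P (0, t)) 1).symm
  have h₁ : ∀ t : ℝ, f (u + t • (v - u)) * (v - u).2 - g (u + t • (v - u)) * (v - u).1 =
      -Q (t, 0) := by
    intro t
    have : u + t • (v - u) = A (t, 0) := by ext <;> simp [hA, triangleParam]
    rw [this]
    simp only [hQ, Prod.fst_sub, Prod.snd_sub]
    ring
  have h₂ : ∀ t : ℝ, f (v + t • (w - v)) * (w - v).2 - g (v + t • (w - v)) * (w - v).1 =
      P (1 - t, t) + Q (1 - t, t) := by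
    intro t
    have : v + t • (w - v) = A (1 - t, t) := by ext <;> simp [hA, triangleParam] <;> ring
    rw [this]
    simp only [hP, hQ, Prod.fst_sub, Prod.snd_sub]
    ring
  have h₃ : ∀ t : ℝ, f (w + t • (u - w)) * (u - w).2 - g (w + t • (u - w)) * (u - w).1 =
      -P (0, 1 - t) := by
    intro t
    have : w + t • (u - w) = A (0, 1 - t) := by ext <;> simp [hA, triangleParam] <;> ring
    rw [this]
    simp only [hP, Prod.fst_sub, Prod.snd_sub]
    ring
  simp only [h₁, h₂, h₃]
  rw [intervalIntegral.integral_add (Continuous.intervalIntegrable (by fun_prop) _ _)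
      (Continuous.intervalIntegrable (by fun_prop) _ _),
    intervalIntegral.integral_neg, intervalIntegral.integral_neg, hflipQ, hflipP]
  ring

/-- The regularized distance `√(‖x - p‖² + γ²)` in the Euclidean plane. -/
noncomputable def regDist (p : ℝ × ℝ) (γ : ℝ) (x : ℝ × ℝ) : ℝ :=
  Real.sqrt ((x.1 - p.1) ^ 2 + (x.2 - p.2) ^ 2 + γ ^ 2)

lemma regDist_sq (p : ℝ × ℝ) (γ : ℝ) (x : ℝ × ℝ) :
    regDist p γ x ^ 2 = (x.1 - p.1) ^ 2 + (x.2 - p.2) ^ 2 + γ ^ 2 :=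
  Real.sq_sqrt (by positivity)

lemma regDist_pos {γ : ℝ} (hγ : 0 < γ) (p x : ℝ × ℝ) : 0 < regDist p γ x :=
  Real.sqrt_pos.2 (by positivity)

lemma contDiff_regDist {γ : ℝ} (hγ : 0 < γ) (p : ℝ × ℝ) : ContDiff ℝ 1 (regDist p γ) :=
  ContDiff.sqrt (by fun_prop) fun x => by positivity

lemma hasFDerivAt_regDist {γ : ℝ} (hγ : 0 < γ) (p x : ℝ × ℝ) :
    HasFDerivAt (regDist p γ)
      (((x.1 - p.1) / regDist p γ x) • ContinuousLinearMap.fst ℝ ℝ ℝ +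
        ((x.2 - p.2) / regDist p γ x) • ContinuousLinearMap.snd ℝ ℝ ℝ) x := by
  have hS : (x.1 - p.1) ^ 2 + (x.2 - p.2) ^ 2 + γ ^ 2 ≠ 0 := by positivity
  have h := (((((hasFDerivAt_fst (𝕜 := ℝ) (p := x)).sub_const p.1).pow 2).add
    (((hasFDerivAt_snd (𝕜 := ℝ) (p := x)).sub_const p.2).pow 2)).add_const (γ ^ 2)).sqrt hS
  have hR := (regDist_pos hγ p x).ne'
  refine h.congr_fderiv ?_
  change (1 / (2 * regDist p γ x)) • _ = _
  ext <;> simp <;> field_simp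

/-- The Laplacian of the regularized distance is `1 / R + γ² / R³`. -/
lemma fderiv_regDist_gradient_divergence {γ : ℝ} (hγ : 0 < γ) (p x : ℝ × ℝ) :
    fderiv ℝ (fun y => (y.1 - p.1) / regDist p γ y) x (1, 0) +
      fderiv ℝ (fun y => (y.2 - p.2) / regDist p γ y) x (0, 1) =
      (regDist p γ x)⁻¹ + γ ^ 2 * (regDist p γ x ^ 3)⁻¹ := by
  have hR := (regDist_pos hγ p x).ne'
  have hd := hasFDerivAt_regDist hγ p x
  have h₁ : HasFDerivAt (fun y => (y.1 - p.1) * (regDist p γ y)⁻¹) _ x :=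
    ((hasFDerivAt_fst (𝕜 := ℝ) (p := x)).sub_const p.1).mul
    ((hasDerivAt_inv hR).comp_hasFDerivAt x hd)
  have h₂ : HasFDerivAt (fun y => (y.2 - p.2) * (regDist p γ y)⁻¹) _ x :=
    ((hasFDerivAt_snd (𝕜 := ℝ) (p := x)).sub_const p.2).mul
    ((hasDerivAt_inv hR).comp_hasFDerivAt x hd)
  simp only [div_eq_mul_inv]
  rw [h₁.fderiv, h₂.fderiv]
  simp
  field_simp
  linear_combination regDist_sq p γ x

/-- Green's first identity over a planar triangle for the base-case integral
`T₀₀₁`: the area integral of `R⁻¹` equals the sum of the edge integrals of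
`∂R/∂n` minus `γ²` times the area integral of `R⁻³`. -/
theorem green_identity_T001
    (v1 v2 v3 p : ℝ × ℝ) (γ : ℝ) (hγ : 0 < γ)
    (hccw : 0 < (v2.1 - v1.1) * (v3.2 - v1.2) - (v2.2 - v1.2) * (v3.1 - v1.1))
    (V : Fin 3 → ℝ × ℝ) (hV0 : V 0 = v1) (hV1 : V 1 = v2) (hV2 : V 2 = v3)
    (e n : Fin 3 → ℝ × ℝ)
    (he : ∀ i, e i = V (i + 1) - V i)
    (hn : ∀ i, n i = ((e i).2, -(e i).1))
    (R : Fin 3 → ℝ → ℝ)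
    (hRi : ∀ i t, R i t =
      Real.sqrt (((V i).1 + t * (e i).1 - p.1)^2 +
        ((V i).2 + t * (e i).2 - p.2)^2 + γ^2)) :
    (∫ x in convexHull ℝ {v1, v2, v3},
        ((x.1 - p.1)^2 + (x.2 - p.2)^2 + γ^2) ^ (-(1:ℝ)/2)) =
    (∑ i : Fin 3, ∫ t in (0:ℝ)..1,
      (((V i).1 + t * (e i).1 - p.1) * (n i).1 +
        ((V i).2 + t * (e i).2 - p.2) * (n i).2) / R i t) -
    γ^2 * ∫ x in convexHull ℝ {v1, v2, v3},
        ((x.1 - p.1)^2 + (x.2 - p.2)^2 + γ^2) ^ (-(3:ℝ)/2) := by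
  have hR : ∀ x, 0 < regDist p γ x := regDist_pos hγ p
  have hRc := contDiff_regDist hγ p
  have hRcont := hRc.continuous
  have hpow₁ : ∀ x : ℝ × ℝ, ((x.1 - p.1) ^ 2 + (x.2 - p.2) ^ 2 + γ ^ 2) ^ (-(1 : ℝ) / 2) =
      (regDist p γ x)⁻¹ := by
    intro x
    rw [← regDist_sq, ← Real.rpow_natCast_mul (hR x).le, ← Real.rpow_neg_one]
    norm_num
  have hpow₃ : ∀ x : ℝ × ℝ, ((x.1 - p.1) ^ 2 + (x.2 - p.2) ^ 2 + γ ^ 2) ^ (-(3 : ℝ) / 2) =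
      (regDist p γ x ^ 3)⁻¹ := by
    intro x
    rw [← regDist_sq, ← Real.rpow_natCast_mul (hR x).le, ← Real.rpow_natCast,
      ← Real.rpow_neg (hR x).le]
    norm_num
  have hK : IsCompact (convexHull ℝ {v1, v2, v3}) := by
    rw [convexHull_eq_image_triangleParam]
    exact isCompact_unitTriangle.image (contDiff_triangleParam v1 v2 v3).continuous
  have hi₁ : IntegrableOn (fun x => (regDist p γ x)⁻¹) (convexHull ℝ {v1, v2, v3}) :=
    (hRcont.inv₀ fun x => (hR x).ne').continuousOn.integrableOn_compact hK
  have hi₃ : IntegrableOn (fun x => γ ^ 2 * (regDist p γ x ^ 3)⁻¹) (convexHull ℝ {v1, v2, v3}) :=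
    (continuous_const.mul ((hRcont.pow 3).inv₀ fun x =>
      (pow_pos (hR x) 3).ne')).continuousOn.integrableOn_compact hK
  have key := setIntegral_convexHull_triangle_divergence hccw
    (f := fun y => (y.1 - p.1) / regDist p γ y) (g := fun y => (y.2 - p.2) / regDist p γ y)
    (ContDiff.div (by fun_prop) hRc fun x => (hR x).ne')
    (ContDiff.div (by fun_prop) hRc fun x => (hR x).ne')
  simp only [fderiv_regDist_gradient_divergence hγ] at key
  rw [integral_add hi₁ hi₃, integral_const_mul] at key
  simp only [hpow₁, hpow₃]
  rw [eq_sub_iff_add_eq, key, Fin.sum_univ_three]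
  have he₀ : e 0 = v2 - v1 := by rw [he, ← hV0, ← hV1]; rfl
  have he₁ : e 1 = v3 - v2 := by rw [he, ← hV1, ← hV2]; rfl
  have he₂ : e 2 = v1 - v3 := by rw [he, ← hV0, ← hV2]; rfl
  have hedge : ∀ a b : ℝ × ℝ, ∀ t : ℝ,
      ((a + t • b).1 - p.1) / regDist p γ (a + t • b) * b.2 -
        ((a + t • b).2 - p.2) / regDist p γ (a + t • b) * b.1 =
      ((a.1 + t * b.1 - p.1) * b.2 + (a.2 + t * b.2 - p.2) * -b.1) /
        Real.sqrt ((a.1 + t * b.1 - p.1) ^ 2 + (a.2 + t * b.2 - p.2) ^ 2 + γ ^ 2) := by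
    intro a b t
    simp only [regDist, Prod.fst_add, Prod.snd_add, Prod.smul_fst, Prod.smul_snd, smul_eq_mul]
    ring
  simp only [hedge, hRi, hn, he₀, he₁, he₂, hV0, hV1, hV2]
end
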